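/- arXiv:2306.15276 — 6 statements merged into one kernel-verified Lean document; each statement's English description precedes it below -/
import Mathlib

section
/- Let d ≥ 1, let P ⊆ [0,1]^d be a finite nonempty point set, and let P* ⊆ P be nonempty. Then the L∞ star discrepancy of the subset P* can be computed on the grid generated by the full set P: d*∞(P*) = max{ max_{q ∈ Γ̄(P)} δ(q,P*), max_{q ∈ Γ(P)} δ̄(q,P*) }, where δ and δ̄ are computed with respect to P* (so counts are normalized by |P*|). -/
open scoped Classical

noncomputable section

/-- The volume (Lebesgue measure) of the anchored box `[0, q)` (equivalently `[0,q]`). -/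
def vol {d : ℕ} (q : Fin d → ℝ) : ℝ := ∏ j, q j

/-- `x` lies in the open anchored box `[0, q) = ∏_j [0, q_j)`. -/
def inOpenBox {d : ℕ} (q x : Fin d → ℝ) : Prop := ∀ j, 0 ≤ x j ∧ x j < q j

/-- `x` lies in the closed anchored box `[0, q] = ∏_j [0, q_j]`. -/
def inClosedBox {d : ℕ} (q x : Fin d → ℝ) : Prop := ∀ j, 0 ≤ x j ∧ x j ≤ q j

/-- `δ(q, P) = λ(q) - D(q, P) / |P|`, using the open box `[0, q)`. -/
def delta {d : ℕ} (q : Fin d → ℝ) (P : Finset (Fin d → ℝ)) : ℝ :=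
  vol q - ((P.filter (fun x => inOpenBox q x)).card : ℝ) / (P.card : ℝ)

/-- `δ̄(q, P) = D̄(q, P) / |P| - λ(q)`, using the closed box `[0, q]`. -/
def deltaBar {d : ℕ} (q : Fin d → ℝ) (P : Finset (Fin d → ℝ)) : ℝ :=
  ((P.filter (fun x => inClosedBox q x)).card : ℝ) / (P.card : ℝ) - vol q

/-- The `L∞` star discrepancy `d*∞(P) = sup_{q ∈ [0,1]^d} max (δ(q,P)) (δ̄(q,P))`. -/
def starDisc {d : ℕ} (P : Finset (Fin d → ℝ)) : ℝ :=
  sSup {x : ℝ | ∃ q : Fin d → ℝ,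
    (∀ j, 0 ≤ q j ∧ q j ≤ 1) ∧ x = max (delta q P) (deltaBar q P)}

lemma vol_nonneg {d : ℕ} {q : Fin d → ℝ} (hq : ∀ j, 0 ≤ q j ∧ q j ≤ 1) : 0 ≤ vol q :=
  Finset.prod_nonneg fun j _ => (hq j).1

lemma vol_le_one {d : ℕ} {q : Fin d → ℝ} (hq : ∀ j, 0 ≤ q j ∧ q j ≤ 1) : vol q ≤ 1 :=
  Finset.prod_le_one (fun j _ => (hq j).1) fun j _ => (hq j).2

lemma vol_mono {d : ℕ} {q r : Fin d → ℝ} (hq : ∀ j, 0 ≤ q j) (h : ∀ j, q j ≤ r j) :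
    vol q ≤ vol r :=
  Finset.prod_le_prod (fun j _ => hq j) fun j _ => h j

lemma delta_le_one {d : ℕ} {q : Fin d → ℝ} (P : Finset (Fin d → ℝ))
    (hq : ∀ j, 0 ≤ q j ∧ q j ≤ 1) : delta q P ≤ 1 :=
  (sub_le_self _ (by positivity)).trans (vol_le_one hq)

lemma deltaBar_le_one {d : ℕ} {q : Fin d → ℝ} (P : Finset (Fin d → ℝ))
    (hq : ∀ j, 0 ≤ q j ∧ q j ≤ 1) : deltaBar q P ≤ 1 :=
  (sub_le_self _ (vol_nonneg hq)).trans <|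
    div_le_one_of_le₀ (by exact_mod_cast Finset.card_filter_le _ _) (by positivity)

/-- Rounding up to the grid: enlarging an open box without capturing further points of `P`
can only increase `delta`. -/
lemma delta_mono {d : ℕ} {q r : Fin d → ℝ} {P : Finset (Fin d → ℝ)} (hq : ∀ j, 0 ≤ q j)
    (h : ∀ j, q j ≤ r j) (hP : ∀ x ∈ P, inOpenBox r x → inOpenBox q x) :
    delta q P ≤ delta r P := by
  have hcard : (P.filter fun x => inOpenBox r x).card ≤ (P.filter fun x => inOpenBox q x).card :=
    Finset.card_le_card fun x hx => by
      rw [Finset.mem_filter] at hx ⊢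
      exact ⟨hx.1, hP x hx.1 hx.2⟩
  unfold delta
  have := vol_mono hq h
  gcongr

/-- Rounding down to the grid: shrinking a closed box without losing points of `P`
can only increase `deltaBar`. -/
lemma deltaBar_anti {d : ℕ} {q r : Fin d → ℝ} {P : Finset (Fin d → ℝ)} (hr : ∀ j, 0 ≤ r j)
    (h : ∀ j, r j ≤ q j) (hP : ∀ x ∈ P, inClosedBox q x → inClosedBox r x) :
    deltaBar q P ≤ deltaBar r P := by
  have hcard :
      (P.filter fun x => inClosedBox q x).card ≤ (P.filter fun x => inClosedBox r x).card :=
    Finset.card_le_card fun x hx => by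
      rw [Finset.mem_filter] at hx ⊢
      exact ⟨hx.1, hP x hx.1 hx.2⟩
  unfold deltaBar
  have := vol_mono hr h
  gcongr

lemma exists_delta_le_grid {d : ℕ} {P Q : Finset (Fin d → ℝ)} (hsub : Q ⊆ P) {q : Fin d → ℝ}
    (hq : ∀ j, 0 ≤ q j ∧ q j ≤ 1) :
    ∃ r : Fin d → ℝ, (∀ j, r j = 1 ∨ ∃ p ∈ P, p j = r j) ∧ delta q Q ≤ delta r Q := by
  have key : ∀ j, ∃ g : ℝ, (g = 1 ∨ ∃ p ∈ P, p j = g) ∧ q j ≤ g ∧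
      ∀ p ∈ P, q j ≤ p j → g ≤ p j := by
    intro j
    obtain ⟨g, hg, hmin⟩ := Finset.exists_min_image
      ((insert 1 (P.image fun p => p j)).filter fun g => q j ≤ g) id
      ⟨1, by simp [(hq j).2]⟩
    simp only [Finset.mem_filter, Finset.mem_insert, Finset.mem_image] at hg
    exact ⟨g, hg.1, hg.2, fun p hp hqp => hmin (p j) <| by
      rw [Finset.mem_filter]
      exact ⟨Finset.mem_insert_of_mem (Finset.mem_image_of_mem _ hp), hqp⟩⟩
  choose r hr hqr hmin using key
  refine ⟨r, hr, delta_mono (fun j => (hq j).1) hqr fun x hx hxr j => ⟨(hxr j).1, ?_⟩⟩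
  by_contra! hlt
  exact (hxr j).2.not_ge (hmin j x (hsub hx) hlt)

/-- If some point of `Q` lies in the closed box `[0, q]`, then `q` can be rounded down. -/
lemma exists_deltaBar_le_grid {d : ℕ} {P Q : Finset (Fin d → ℝ)} (hsub : Q ⊆ P)
    (hcube : ∀ p ∈ P, ∀ j, 0 ≤ p j) {q x : Fin d → ℝ} (hx : x ∈ Q) (hxq : inClosedBox q x) :
    ∃ r : Fin d → ℝ, (∀ j, ∃ p ∈ P, p j = r j) ∧ deltaBar q Q ≤ deltaBar r Q := by
  have key : ∀ j, ∃ p ∈ P, p j ≤ q j ∧ ∀ p' ∈ P, p' j ≤ q j → p' j ≤ p j := by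
    intro j
    obtain ⟨p, hp, hmax⟩ := Finset.exists_max_image (P.filter fun p => p j ≤ q j) (fun p => p j)
      ⟨x, Finset.mem_filter.2 ⟨hsub hx, (hxq j).2⟩⟩
    rw [Finset.mem_filter] at hp
    exact ⟨p, hp.1, hp.2, fun p' hp' hle => hmax p' (Finset.mem_filter.2 ⟨hp', hle⟩)⟩
  choose p hp hpq hmax using key
  exact ⟨fun j => p j j, fun j => ⟨p j, hp j, rfl⟩,
    deltaBar_anti (fun j => hcube _ (hp j) j) hpq fun y hy hyq j =>
      ⟨(hyq j).1, hmax j y (hsub hy) (hyq j).2⟩⟩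

lemma exists_grid_deltaBar_nonneg {d : ℕ} {P Q : Finset (Fin d → ℝ)} (hsub : Q ⊆ P)
    (hQ : Q.Nonempty) (hcube : ∀ p ∈ P, ∀ j, 0 ≤ p j ∧ p j ≤ 1) :
    ∃ r : Fin d → ℝ, (∀ j, ∃ p ∈ P, p j = r j) ∧ 0 ≤ deltaBar r Q := by
  obtain ⟨x, hx⟩ := hQ
  have hbox : ∀ y ∈ Q, inClosedBox (fun _ => 1) y := fun y hy => hcube y (hsub hy)
  obtain ⟨r, hr, hle⟩ :=
    exists_deltaBar_le_grid hsub (fun p hp j => (hcube p hp j).1) hx (hbox x hx)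
  refine ⟨r, hr, le_trans ?_ hle⟩
  have hne : (Q.card : ℝ) ≠ 0 := by exact_mod_cast Finset.card_ne_zero_of_mem hx
  simp [deltaBar, vol, Finset.filter_true_of_mem hbox, hne]

/-- The star discrepancy of a nonempty subset `P* ⊆ P` can be computed on the grid
generated by the full set `P`:
`d*∞(P*) = max { max_{q ∈ Γ̄(P)} δ(q,P*), max_{q ∈ Γ(P)} δ̄(q,P*) }`. -/
theorem starDisc_subset_eq_max_on_grid {d : ℕ} (hd : 1 ≤ d)
    (P Pstar : Finset (Fin d → ℝ)) (hsub : Pstar ⊆ P) (hPstar : Pstar.Nonempty)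
    (hcube : ∀ p ∈ P, ∀ j, 0 ≤ p j ∧ p j ≤ 1) :
    starDisc Pstar =
      max
        (sSup {x : ℝ | ∃ q : Fin d → ℝ,
          (∀ j, q j = 1 ∨ ∃ p ∈ P, p j = q j) ∧ x = delta q Pstar})
        (sSup {x : ℝ | ∃ q : Fin d → ℝ,
          (∀ j, ∃ p ∈ P, p j = q j) ∧ x = deltaBar q Pstar}) := by
  have hgrid : ∀ q : Fin d → ℝ, (∀ j, ∃ p ∈ P, p j = q j) → ∀ j, 0 ≤ q j ∧ q j ≤ 1 := by
    intro q hq j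
    obtain ⟨p, hp, hpq⟩ := hq j
    exact hpq ▸ hcube p hp j
  have hgrid' : ∀ q : Fin d → ℝ, (∀ j, q j = 1 ∨ ∃ p ∈ P, p j = q j) →
      ∀ j, 0 ≤ q j ∧ q j ≤ 1 := by
    intro q hq j
    obtain h | ⟨p, hp, hpq⟩ := hq j
    · simp [h]
    · exact hpq ▸ hcube p hp j
  have hbdd : BddAbove {x : ℝ | ∃ q : Fin d → ℝ,
      (∀ j, 0 ≤ q j ∧ q j ≤ 1) ∧ x = max (delta q Pstar) (deltaBar q Pstar)} := by
    refine ⟨1, ?_⟩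
    rintro _ ⟨q, hq, rfl⟩
    exact max_le (delta_le_one _ hq) (deltaBar_le_one _ hq)
  have hbdd_delta : BddAbove {x : ℝ | ∃ q : Fin d → ℝ,
      (∀ j, q j = 1 ∨ ∃ p ∈ P, p j = q j) ∧ x = delta q Pstar} := by
    refine ⟨1, ?_⟩
    rintro _ ⟨q, hq, rfl⟩
    exact delta_le_one _ (hgrid' q hq)
  have hbdd_deltaBar : BddAbove {x : ℝ | ∃ q : Fin d → ℝ,
      (∀ j, ∃ p ∈ P, p j = q j) ∧ x = deltaBar q Pstar} := by
    refine ⟨1, ?_⟩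
    rintro _ ⟨q, hq, rfl⟩
    exact deltaBar_le_one _ (hgrid q hq)
  obtain ⟨r₀, hr₀, hr₀_nonneg⟩ := exists_grid_deltaBar_nonneg hsub hPstar hcube
  unfold starDisc
  apply le_antisymm
  · refine csSup_le ⟨_, r₀, hgrid r₀ hr₀, rfl⟩ ?_
    rintro _ ⟨q, hq, rfl⟩
    refine max_le_max ?_ ?_
    · obtain ⟨r, hr, hle⟩ := exists_delta_le_grid hsub hq
      exact hle.trans (le_csSup hbdd_delta ⟨r, hr, rfl⟩)
    · by_cases hx : ∃ x ∈ Pstar, inClosedBox q x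
      · obtain ⟨x, hx, hxq⟩ := hx
        obtain ⟨r, hr, hle⟩ :=
          exists_deltaBar_le_grid hsub (fun p hp j => (hcube p hp j).1) hx hxq
        exact hle.trans (le_csSup hbdd_deltaBar ⟨r, hr, rfl⟩)
      · push Not at hx
        have hle : deltaBar q Pstar ≤ 0 := by
          simpa [deltaBar, Finset.filter_false_of_mem hx] using vol_nonneg hq
        exact (hle.trans hr₀_nonneg).trans (le_csSup hbdd_deltaBar ⟨r₀, hr₀, rfl⟩)
  · refine max_le (csSup_le ⟨_, fun _ => 1, fun _ => Or.inl rfl, rfl⟩ ?_)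
      (csSup_le ⟨_, r₀, hr₀, rfl⟩ ?_)
    · rintro _ ⟨q, hq, rfl⟩
      exact (le_max_left _ _).trans (le_csSup hbdd ⟨q, hgrid' q hq, rfl⟩)
    · rintro _ ⟨q, hq, rfl⟩
      exact (le_max_right _ _).trans (le_csSup hbdd ⟨q, hgrid q hq, rfl⟩)
end
end

section
/- Under the hypotheses of the construction of P_A, the set P_A = {p_1,…,p_k} ⊆ [0,1]^2 has exactly k points and its L∞ star discrepancy equals 1 − α, i.e. d*∞(P_A) = 1 − α. -/
open scoped Classical

noncomputable section

/-- The points `p_i = (q_{i,1}, q_{i+1,2})` of the construction (0-indexed: the paper's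
`p_{i+1}` is `pA q i` for `0 ≤ i ≤ k-1`). -/
def pA (q : ℕ → Fin 2 → ℝ) (i : ℕ) : Fin 2 → ℝ := ![q i 0, q (i + 1) 1]

/-- The point set `P_A = {p_1, …, p_k}`. -/
def PA (k : ℕ) (q : ℕ → Fin 2 → ℝ) : Finset (Fin 2 → ℝ) :=
  (Finset.range k).image (pA q)

/-- The points of the construction of `P_B` (0-indexed: the paper's `p_{k+i}` is
`pB q γ δ (i-1)` for `1 ≤ i ≤ k`): `p_{k+1} = (q_{1,1} - γ, q_{2,2} - δ)` and
`p_{k+i} = (q_{i,1}, q_{i+1,2} - δ)` for `2 ≤ i ≤ k`. -/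
def pB (q : ℕ → Fin 2 → ℝ) (γ δ : ℝ) (m : ℕ) : Fin 2 → ℝ :=
  if m = 0 then ![q 0 0 - γ, q 1 1 - δ] else ![q m 0, q (m + 1) 1 - δ]

/-- The point set `P_B = {p_{k+1}, …, p_{2k}}`. -/
def PB (k : ℕ) (q : ℕ → Fin 2 → ℝ) (γ δ : ℝ) : Finset (Fin 2 → ℝ) :=
  (Finset.range k).image (pB q γ δ)

/-- A subbox of the unit square avoiding, in the open sense, all inner corners `(a i, b (i + 1))`
of a staircase has area at most the common area of the outer corners `(a i, b i)`. -/
theorem mul_le_of_avoids_staircase {k : ℕ} {a b : ℕ → ℝ} {c x y : ℝ}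
    (ha : ∀ i ≤ k, 0 < a i) (hcurve : ∀ i ≤ k, a i * b i = c)
    (hb : b 0 = 1) (hy : 0 ≤ y) (hy1 : y ≤ 1)
    (havoid : ∀ i < k, a i < x → y ≤ b (i + 1)) {i : ℕ} (hi : i ≤ k) (hxi : x ≤ a i) :
    x * y ≤ c := by
  induction i with
  | zero =>
    rw [← hcurve 0 hi, hb]
    exact mul_le_mul hxi hy1 hy (ha 0 hi).le
  | succ n ih =>
    rcases le_or_gt x (a n) with h | h
    · exact ih (Nat.le_of_succ_le hi) h
    · rw [← hcurve (n + 1) hi]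
      exact mul_le_mul hxi (havoid n hi h) hy (ha _ hi).le

/-- Under the hypotheses of the construction of `P_A` (here the paper's `q_i`, for
`1 ≤ i ≤ k+1`, is `q (i-1)`), the set `P_A` has exactly `k` points and its `L∞` star
discrepancy equals `1 - α`. -/
theorem starDisc_PA (k : ℕ) (hk : 2 ≤ k) (α : ℝ) (hα0 : 0 < α) (hα1 : α < 1 / (2 * k))
    (q : ℕ → Fin 2 → ℝ)
    (hq_mem : ∀ i ≤ k, ∀ j, 0 < q i j ∧ q i j ≤ 1)
    (hq_curve : ∀ i ≤ k, q i 0 * q i 1 = 1 - α)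
    (hq_first : q 0 1 = 1) (hq_last : q k 0 = 1)
    (hq_mono : ∀ i < k, q i 0 < q (i + 1) 0)
    (hq_gt : ∀ i < k, 1 - 1 / (2 * k) < q i 0 * q (i + 1) 1) :
    (PA k q).card = k ∧ starDisc (PA k q) = 1 - α := by
  have hmono : StrictMonoOn (fun i => q i 0) (Set.Iic k) := strictMonoOn_Iic_of_lt_succ hq_mono
  have hcard : (PA k q).card = k := by
    rw [PA, Finset.card_image_of_injOn, Finset.card_range]
    intro i hi j hj hij
    have hi' : i < k := by simpa using hi
    have hj' : j < k := by simpa using hj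
    exact hmono.injOn hi'.le hj'.le (by simpa [pA] using congrFun hij 0)
  refine ⟨hcard, IsGreatest.csSup_eq ⟨?_, ?_⟩⟩
  all_goals
    have hk' : (2 : ℝ) ≤ k := by exact_mod_cast hk
    have hkpos : (0 : ℝ) < k := by linarith
    have hhalf : 1 / (2 * (k : ℝ)) ≤ 1 / 4 := by
      apply one_div_le_one_div_of_le <;> linarith
    have hbar : ∀ x : Fin 2 → ℝ, (∀ j, 0 ≤ x j ∧ x j ≤ 1) → deltaBar x (PA k q) ≤ 1 - α := by
      intro x hx
      have hvol : vol x = x 0 * x 1 := by simp [vol, Fin.prod_univ_two]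
      have hvol0 : 0 ≤ x 0 * x 1 := mul_nonneg (hx 0).1 (hx 1).1
      rw [deltaBar, hcard, hvol]
      rcases ((PA k q).filter (fun y => inClosedBox x y)).eq_empty_or_nonempty with h | ⟨y, hy⟩
      · rw [h]
        simp only [Finset.card_empty, Nat.cast_zero, zero_div]
        linarith
      · obtain ⟨hyP, hyx⟩ := Finset.mem_filter.1 hy
        obtain ⟨i, hi, rfl⟩ := Finset.mem_image.1 hyP
        have hi' : i < k := by simpa using hi
        have h0 : q i 0 ≤ x 0 := (hyx 0).2
        have h1 : q (i + 1) 1 ≤ x 1 := (hyx 1).2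
        have hle : q i 0 * q (i + 1) 1 ≤ x 0 * x 1 :=
          mul_le_mul h0 h1 (hq_mem _ hi' 1).1.le (hx 0).1
        have hone : (((PA k q).filter (fun y => inClosedBox x y)).card : ℝ) / k ≤ 1 := by
          rw [div_le_one hkpos]
          exact_mod_cast (Finset.card_filter_le _ _).trans hcard.le
        have := hq_gt i hi'
        linarith
  · refine ⟨q 0, fun j => ⟨(hq_mem 0 (Nat.zero_le k) j).1.le, (hq_mem 0 (Nat.zero_le k) j).2⟩, ?_⟩
    have hempty : (PA k q).filter (fun y => inOpenBox (q 0) y) = ∅ := by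
      refine Finset.filter_eq_empty_iff.2 fun y hy hbox => ?_
      obtain ⟨i, hi, rfl⟩ := Finset.mem_image.1 hy
      have hi' : i < k := by simpa using hi
      have hlt : q i 0 < q 0 0 := (hbox 0).2
      exact hlt.not_ge (hmono.monotoneOn (Nat.zero_le k) hi'.le (Nat.zero_le i))
    have hdelta : delta (q 0) (PA k q) = 1 - α := by
      simp [delta, hempty, vol, Fin.prod_univ_two, hq_curve 0 (Nat.zero_le k)]
    rw [hdelta, max_eq_left]
    exact hbar _ fun j => ⟨(hq_mem 0 (Nat.zero_le k) j).1.le, (hq_mem 0 (Nat.zero_le k) j).2⟩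
  · rintro _ ⟨x, hx, rfl⟩
    refine max_le ?_ (hbar x hx)
    have hvol : vol x = x 0 * x 1 := by simp [vol, Fin.prod_univ_two]
    rw [delta, hcard, hvol]
    rcases ((PA k q).filter (fun y => inOpenBox x y)).eq_empty_or_nonempty with h | h
    · rw [h]
      simp only [Finset.card_empty, Nat.cast_zero, zero_div, sub_zero]
      refine mul_le_of_avoids_staircase (a := fun i => q i 0) (b := fun i => q i 1)
        (fun i hi => (hq_mem i hi 0).1) hq_curve hq_first (hx 1).1 (hx 1).2 ?_ le_rfl
        ((hx 0).2.trans hq_last.ge)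
      intro i hi hlt
      by_contra! hcon
      refine Finset.filter_eq_empty_iff.1 h
        (Finset.mem_image_of_mem (pA q) (Finset.mem_range.2 hi)) (Fin.forall_fin_two.2 ⟨?_, ?_⟩)
      · exact ⟨(hq_mem i hi.le 0).1.le, hlt⟩
      · exact ⟨(hq_mem (i + 1) hi 1).1.le, hcon⟩
    · have hone : 1 / (k : ℝ) ≤ (((PA k q).filter (fun y => inOpenBox x y)).card : ℝ) / k := by
        gcongr
        exact_mod_cast h.card_pos
      have hvol1 : x 0 * x 1 ≤ 1 := mul_le_one₀ (hx 0).2 (hx 1).1 (hx 1).2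
      have hhalf' : 1 / (2 * (k : ℝ)) ≤ 1 / k := by
        apply one_div_le_one_div_of_le <;> linarith
      linarith
end
end

section
/- Under the hypotheses of the constructions of P_A and P_B, the set P_B = {p_{k+1},…,p_{2k}} ⊆ [0,1]^2 has exactly k points and its L∞ star discrepancy is strictly smaller than that of P_A: d*∞(P_B) < 1 − α = d*∞(P_A). -/
open scoped Classical

noncomputable section

/-- A box in the unit square that avoids a finite chain of points has volume at most `M`, provided
that the boxes spanned by consecutive points of the chain have volume at most `M`. -/
lemma mul_le_of_forall_not_inOpenBox {k : ℕ} (hk : 0 < k) {f : ℕ → Fin 2 → ℝ} {M : ℝ}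
    (hf : ∀ i < k, ∀ j, 0 ≤ f i j) (hstart : f 0 0 ≤ M)
    (hstep : ∀ i, i + 1 < k → f (i + 1) 0 * f i 1 ≤ M) (hend : f (k - 1) 1 ≤ M)
    {r : Fin 2 → ℝ} (hr : ∀ j, 0 ≤ r j ∧ r j ≤ 1) (h : ∀ i < k, ¬ inOpenBox r (f i)) :
    r 0 * r 1 ≤ M := by
  by_contra! hM
  have hr0 := hr 0
  have hr1 := hr 1
  have key : ∀ i < k, f i 0 < r 0 → r 1 ≤ f i 1 := by
    intro i hi hlt
    by_contra! hlt'
    refine h i hi fun j => ⟨hf i hi j, ?_⟩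
    fin_cases j
    exacts [hlt, hlt']
  have all : ∀ i < k, f i 0 < r 0 := by
    intro i
    induction i with
    | zero => intro _; nlinarith
    | succ i ih =>
      intro hi
      by_contra! hle
      have h1 := key i (by omega) (ih (by omega))
      have h2 := mul_le_mul hle h1 hr1.1 (hf _ hi 0)
      linarith [hstep i hi]
  have h1 := key (k - 1) (by omega) (all _ (by omega))
  nlinarith

lemma max_delta_deltaBar_le {k : ℕ} (hk : 0 < k) {f : ℕ → Fin 2 → ℝ} {M c : ℝ}
    (hcard : ((Finset.range k).image f).card = k) (hf : ∀ i < k, ∀ j, 0 ≤ f i j)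
    (hvol : ∀ i < k, 1 - c ≤ f i 0 * f i 1) (hc : c ≤ M) (hM : 1 - 1 / (k : ℝ) ≤ M)
    (hstart : f 0 0 ≤ M) (hstep : ∀ i, i + 1 < k → f (i + 1) 0 * f i 1 ≤ M)
    (hend : f (k - 1) 1 ≤ M) {r : Fin 2 → ℝ} (hr : ∀ j, 0 ≤ r j ∧ r j ≤ 1) :
    max (delta r ((Finset.range k).image f)) (deltaBar r ((Finset.range k).image f)) ≤ M := by
  have hr0 := hr 0
  have hr1 := hr 1
  have hk' : (0 : ℝ) < k := by exact_mod_cast hk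
  refine max_le ?_ ?_
  · rw [delta, hcard, vol, Fin.prod_univ_two]
    by_cases h : ∀ i < k, ¬ inOpenBox r (f i)
    · have hvolr := mul_le_of_forall_not_inOpenBox hk hf hstart hstep hend hr h
      linarith [show (0 : ℝ) ≤ (({x ∈ (Finset.range k).image f | inOpenBox r x}).card : ℝ) / k
        by positivity]
    · push Not at h
      obtain ⟨i, hi, hbox⟩ := h
      have hpos : 1 ≤ ({x ∈ (Finset.range k).image f | inOpenBox r x}).card :=
        Finset.card_pos.mpr ⟨f i, Finset.mem_filter.mpr
          ⟨Finset.mem_image_of_mem f (Finset.mem_range.mpr hi), hbox⟩⟩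
      have hdiv : 1 / (k : ℝ) ≤ (({x ∈ (Finset.range k).image f | inOpenBox r x}).card : ℝ) / k := by
        gcongr
        exact_mod_cast hpos
      nlinarith
  · rw [deltaBar, hcard, vol, Fin.prod_univ_two]
    by_cases h : ∀ i < k, ¬ inClosedBox r (f i)
    · have hempty : {x ∈ (Finset.range k).image f | inClosedBox r x} = ∅ := by
        simpa [Finset.filter_eq_empty_iff] using h
      have hk1 : 1 / (k : ℝ) ≤ 1 := by
        rw [div_le_one hk']
        exact_mod_cast hk
      rw [hempty, Finset.card_empty, Nat.cast_zero, zero_div]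
      linarith [mul_nonneg hr0.1 hr1.1]
    · push Not at h
      obtain ⟨i, hi, hbox⟩ := h
      have hle : ({x ∈ (Finset.range k).image f | inClosedBox r x}).card ≤ k :=
        (Finset.card_filter_le _ _).trans hcard.le
      have hdiv : (({x ∈ (Finset.range k).image f | inClosedBox r x}).card : ℝ) / k ≤ 1 := by
        rw [div_le_one hk']
        exact_mod_cast hle
      have hmul := mul_le_mul (hbox 0).2 (hbox 1).2 (hbox 1).1 hr0.1
      linarith [hvol i hi]

lemma card_image_range_of_fst_lt {k : ℕ} {f : ℕ → Fin 2 → ℝ}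
    (hf : ∀ i j, i < j → j < k → f i 0 < f j 0) : ((Finset.range k).image f).card = k := by
  rw [Finset.card_image_of_injOn, Finset.card_range]
  intro i hi j hj hij
  simp only [Finset.coe_range, Set.mem_Iio] at hi hj
  rcases lt_trichotomy i j with h | h | h
  · exact absurd (congrFun hij 0) (hf i j h hj).ne
  · exact h
  · exact absurd (congrFun hij 0) (hf j i h hi).ne.symm


/-- Under the hypotheses of the constructions of `P_A` and `P_B` (the paper's `q_i`,
`1 ≤ i ≤ k+1`, is `q (i-1)`), `P_B` has exactly `k` points and
`d*∞(P_B) < 1 - α = d*∞(P_A)`. -/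
theorem starDisc_PB_lt_starDisc_PA (k : ℕ) (hk : 2 ≤ k)
    (α : ℝ) (hα0 : 0 < α) (hα1 : α < 1 / (2 * k))
    (q : ℕ → Fin 2 → ℝ)
    (hq_mem : ∀ i ≤ k, ∀ j, 0 < q i j ∧ q i j ≤ 1)
    (hq_curve : ∀ i ≤ k, q i 0 * q i 1 = 1 - α)
    (hq_first : q 0 1 = 1) (hq_last : q k 0 = 1)
    (hq_mono : ∀ i < k, q i 0 < q (i + 1) 0)
    (hq_gt : ∀ i < k, 1 - 1 / (2 * k) < q i 0 * q (i + 1) 1)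
    (δ γ : ℝ) (hδ0 : 0 < δ) (hγ0 : 0 < γ)
    (hδ_gap : ∀ i, 1 ≤ i → i < k → δ < q i 1 - q (i + 1) 1)
    (hδ_hyp : ∀ i, 1 ≤ i → i < k → 1 - 1 / (k : ℝ) ≤ q i 0 * (q (i + 1) 1 - δ))
    (hγ_lt : γ < q 0 0)
    (hγδ_hyp : 1 - 1 / (k : ℝ) ≤ (q 0 0 - γ) * (q 1 1 - δ)) :
    (PB k q γ δ).card = k ∧
    starDisc (PB k q γ δ) < 1 - α ∧ starDisc (PA k q) = 1 - α := by
  have hk2 : (2 : ℝ) ≤ k := by exact_mod_cast hk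
  have hkinv : 1 / (k : ℝ) ≤ 1 / 2 := by gcongr
  have hhalf : 1 / (2 * (k : ℝ)) = 1 / k / 2 := by field_simp
  have hkpos : 0 < 1 / (k : ℝ) := by positivity
  rw [hhalf] at hα1
  simp only [hhalf] at hq_gt
  have ha0 : q 0 0 = 1 - α := by simpa [hq_first] using hq_curve 0 (by omega)
  have hbk : q k 1 = 1 - α := by simpa [hq_last] using hq_curve k le_rfl
  have hlt : ∀ i j, i < j → j ≤ k → q i 0 < q j 0 := by
    intro i j hij
    induction j, hij using Nat.le_induction with
    | base => exact fun h => hq_mono i h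
    | succ j _ ih => exact fun h => (ih (by omega)).trans (hq_mono j h)
  have hle : ∀ i ≤ k, q 0 0 ≤ q i 0 := by
    intro i hi
    rcases i.eq_zero_or_pos with rfl | h
    exacts [le_rfl, (hlt 0 i h hi).le]
  have hpA : ∀ i, pA q i 0 = q i 0 ∧ pA q i 1 = q (i + 1) 1 := fun i => ⟨rfl, rfl⟩
  have hpB0 : pB q γ δ 0 0 = q 0 0 - γ := rfl
  have hpB : ∀ i, 1 ≤ i → pB q γ δ i 0 = q i 0 := by
    intro i hi
    simp [pB, show i ≠ 0 by omega]
  have hpB1 : ∀ i, pB q γ δ i 1 = q (i + 1) 1 - δ := by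
    intro i
    rcases i.eq_zero_or_pos with rfl | h
    · rfl
    · simp [pB, h.ne']
  have cardA : ((Finset.range k).image (pA q)).card = k :=
    card_image_range_of_fst_lt fun i j hij hj => hlt i j hij hj.le
  have cardB : ((Finset.range k).image (pB q γ δ)).card = k := by
    refine card_image_range_of_fst_lt fun i j hij hj => ?_
    rw [hpB j (by omega)]
    rcases i.eq_zero_or_pos with rfl | h
    · linarith [hlt 0 j hij hj.le]
    · rw [hpB i h]
      exact hlt i j hij hj.le
  have volB : ∀ i < k, 1 - 1 / (k : ℝ) ≤ pB q γ δ i 0 * pB q γ δ i 1 := by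
    intro i hi
    rw [hpB1]
    rcases i.eq_zero_or_pos with rfl | h
    · exact hγδ_hyp
    · rw [hpB i h]
      exact hδ_hyp i h hi
  have posB : ∀ i < k, ∀ j, 0 ≤ pB q γ δ i j := by
    intro i hi
    have hfst : 0 < pB q γ δ i 0 := by
      rcases i.eq_zero_or_pos with rfl | h
      · rw [hpB0]; linarith
      · rw [hpB i h]; exact (hq_mem i hi.le 0).1
    have hsnd : 0 < pB q γ δ i 1 :=
      pos_of_mul_pos_right (by linarith [volB i hi]) hfst.le
    rw [Fin.forall_fin_two]
    exact ⟨hfst.le, hsnd.le⟩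
  have boundA : ∀ r : Fin 2 → ℝ, (∀ j, 0 ≤ r j ∧ r j ≤ 1) →
      max (delta r (PA k q)) (deltaBar r (PA k q)) ≤ 1 - α := by
    intro r hr
    refine max_delta_deltaBar_le (by omega) cardA (M := 1 - α) (c := 1 / (k : ℝ) / 2) ?_ ?_
      (by linarith) (by linarith) ?_ ?_ ?_ hr
    · intro i hi
      rw [Fin.forall_fin_two]
      exact ⟨(hq_mem i hi.le 0).1.le, (hq_mem (i + 1) hi 1).1.le⟩
    · exact fun i hi => (hq_gt i hi).le
    · exact ha0.le
    · exact fun i hi => (hq_curve (i + 1) hi.le).le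
    · rw [(hpA _).2, show k - 1 + 1 = k by omega, hbk]
  refine ⟨cardB, ?_, le_antisymm (csSup_le ⟨_, 0, by simp, rfl⟩ ?_) ?_⟩
  · have hδa : 0 < δ * q 0 0 := mul_pos hδ0 (by linarith)
    set M := max (1 - 1 / (k : ℝ)) (max (1 - α - γ) (1 - α - δ * q 0 0))
    have hM1 : 1 - 1 / (k : ℝ) ≤ M := le_max_left _ _
    have hM2 : 1 - α - γ ≤ M := (le_max_left _ _).trans (le_max_right _ _)
    have hM3 : 1 - α - δ * q 0 0 ≤ M := (le_max_right _ _).trans (le_max_right _ _)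
    have hM : M < 1 - α :=
      max_lt (by linarith) (max_lt (by linarith) (by linarith))
    refine lt_of_le_of_lt (csSup_le ⟨_, 0, by simp, rfl⟩ ?_) hM
    rintro _ ⟨r, hr, rfl⟩
    refine max_delta_deltaBar_le (by omega) cardB posB volB (by linarith) hM1 ?_ ?_ ?_ hr
    · rw [hpB0]; linarith
    · intro i hi
      rw [hpB1, hpB _ (by omega)]
      nlinarith [hq_curve (i + 1) hi.le, hle (i + 1) hi.le]
    · rw [hpB1, show k - 1 + 1 = k by omega, hbk]
      nlinarith
  · rintro _ ⟨r, hr, rfl⟩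
    exact boundA r hr
  · have hempty : {x ∈ PA k q | inOpenBox (q 0) x} = ∅ := by
      rw [Finset.filter_eq_empty_iff]
      intro x hx hbox
      obtain ⟨i, hi, rfl⟩ := Finset.mem_image.mp hx
      exact absurd (hbox 0).2 (hle i (Finset.mem_range.mp hi).le).not_gt
    have hdelta : delta (q 0) (PA k q) = 1 - α := by
      simp [delta, hempty, vol, Fin.prod_univ_two, ha0, hq_first]
    have hq0 : ∀ j, 0 ≤ q 0 j ∧ q 0 j ≤ 1 := fun j =>
      ⟨(hq_mem 0 (by omega) j).1.le, (hq_mem 0 (by omega) j).2⟩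
    calc 1 - α ≤ max (delta (q 0) (PA k q)) (deltaBar (q 0) (PA k q)) :=
          hdelta.ge.trans (le_max_left _ _)
      _ ≤ starDisc (PA k q) := le_csSup
          ⟨1 - α, by rintro _ ⟨r, hr, rfl⟩; exact boundA r hr⟩ ⟨q 0, hq0, rfl⟩
end
end

section
/- Under the hypotheses of the constructions of P_A and P_B, set P = P_A ∪ P_B (so |P| = 2k) and let P_C ⊆ P with |P_C| = k. If there exists an index i ∈ {1,…,k} with p_i ∈ P_C and p_{k+i} ∉ P_C, then the open anchored box with upper-right corner (p_{i+1,1}, p_{i,2}) (with the convention p_{k+1,1} replaced by 1, i.e. corner (1, p_{k,2}) for i = k) contains no point of P_C; consequently d*∞(P_C) ≥ 1 − α. -/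
open scoped Classical

noncomputable section

theorem le_starDisc {d : ℕ} {q : Fin d → ℝ} (hq : ∀ j, 0 ≤ q j ∧ q j ≤ 1)
    (P : Finset (Fin d → ℝ)) : delta q P ≤ starDisc P := by
  refine le_trans (le_max_left _ (deltaBar q P)) (le_csSup ⟨1, ?_⟩ ⟨q, hq, rfl⟩)
  rintro _ ⟨r, hr, rfl⟩
  have hvol_le : vol r ≤ 1 := Finset.prod_le_one (fun j _ => (hr j).1) (fun j _ => (hr j).2)
  have hvol_nonneg : 0 ≤ vol r := Finset.prod_nonneg (fun j _ => (hr j).1)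
  have h_open :
      0 ≤ ((P.filter (fun x => inOpenBox r x)).card : ℝ) / (P.card : ℝ) := by positivity
  have h_closed : ((P.filter (fun x => inClosedBox r x)).card : ℝ) / (P.card : ℝ) ≤ 1 :=
    div_le_one_of_le₀ (by exact_mod_cast Finset.card_filter_le _ _) (by positivity)
  unfold delta deltaBar
  exact max_le (by linarith) (by linarith)

theorem delta_eq_vol_of_forall_not_inOpenBox {d : ℕ} {q : Fin d → ℝ}
    {P : Finset (Fin d → ℝ)} (h : ∀ x ∈ P, ¬ inOpenBox q x) : delta q P = vol q := by
  simp [delta, Finset.filter_eq_empty_iff.mpr h]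

/-- The second coordinates of points on a hyperbola decrease as the first ones increase. -/
theorem snd_antitoneOn {k : ℕ} {c : ℝ} {q : ℕ → Fin 2 → ℝ}
    (hpos : ∀ i ≤ k, ∀ j, 0 < q i j) (hcurve : ∀ i ≤ k, q i 0 * q i 1 = c)
    (hmono : MonotoneOn (fun i => q i 0) (Set.Iic k)) :
    AntitoneOn (fun i => q i 1) (Set.Iic k) := by
  intro a ha b hb hab
  have h₁ : q a 0 ≤ q b 0 := hmono ha hb hab
  have h₂ : q a 0 * q a 1 = q b 0 * q b 1 := (hcurve a ha).trans (hcurve b hb).symm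
  refine le_of_mul_le_mul_left ?_ (hpos a ha 0)
  calc q a 0 * q b 1 ≤ q b 0 * q b 1 := mul_le_mul_of_nonneg_right h₁ (hpos b hb 1).le
    _ = q a 0 * q a 1 := h₂.symm

/-- Under the constructions of `P_A` and `P_B`, let `P = P_A ∪ P_B` and `P_C ⊆ P` with
`|P_C| = k`. If for some `i` (0-indexed, corresponding to the paper's `i+1 ∈ {1,…,k}`)
`p_{i+1} ∈ P_C` while `p_{k+i+1} ∉ P_C`, then the open anchored box with upper-right
corner `(q_{i+2,1}, q_{i+2,2})` — which is `(p_{i+2,1}, p_{i+1,2})`, with the convention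
that the first coordinate is `1` for the last index since `q_{k+1,1} = 1` — contains no
point of `P_C`; consequently `d*∞(P_C) ≥ 1 - α`. -/
theorem empty_box_of_kept_point (k : ℕ) (hk : 2 ≤ k)
    (α : ℝ) (hα0 : 0 < α) (hα1 : α < 1 / (2 * k))
    (q : ℕ → Fin 2 → ℝ)
    (hq_mem : ∀ i ≤ k, ∀ j, 0 < q i j ∧ q i j ≤ 1)
    (hq_curve : ∀ i ≤ k, q i 0 * q i 1 = 1 - α)
    (hq_first : q 0 1 = 1) (hq_last : q k 0 = 1)
    (hq_mono : ∀ i < k, q i 0 < q (i + 1) 0)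
    (hq_gt : ∀ i < k, 1 - 1 / (2 * k) < q i 0 * q (i + 1) 1)
    (δ γ : ℝ) (hδ0 : 0 < δ) (hγ0 : 0 < γ)
    (hδ_gap : ∀ i, 1 ≤ i → i < k → δ < q i 1 - q (i + 1) 1)
    (hδ_hyp : ∀ i, 1 ≤ i → i < k → 1 - 1 / (k : ℝ) ≤ q i 0 * (q (i + 1) 1 - δ))
    (hγ_lt : γ < q 0 0)
    (hγδ_hyp : 1 - 1 / (k : ℝ) ≤ (q 0 0 - γ) * (q 1 1 - δ))
    (PC : Finset (Fin 2 → ℝ)) (hPC : PC ⊆ PA k q ∪ PB k q γ δ) (hPCcard : PC.card = k)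
    (i : ℕ) (hik : i < k) (hin : pA q i ∈ PC) (hout : pB q γ δ i ∉ PC) :
    (∀ x ∈ PC, ¬ inOpenBox (q (i + 1)) x) ∧ 1 - α ≤ starDisc PC := by
  have h_fst : MonotoneOn (fun n => q n 0) (Set.Iic k) := by
    intro a _ b hb hab
    induction b, hab using Nat.le_induction with
    | base => exact le_rfl
    | succ n _ ih =>
      have hn : n < k := hb
      exact (ih hn.le).trans (hq_mono n hn).le
  have h_snd : AntitoneOn (fun n => q n 1) (Set.Iic k) :=
    snd_antitoneOn (fun n hn j => (hq_mem n hn j).1) hq_curve h_fst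
  have h_empty : ∀ x ∈ PC, ¬ inOpenBox (q (i + 1)) x := by
    intro x hx hbox
    have hbox₀ := (hbox 0).2
    have hbox₁ := (hbox 1).2
    rcases Finset.mem_union.mp (hPC hx) with hxA | hxB
    · obtain ⟨m, hm, rfl⟩ := Finset.mem_image.mp hxA
      have hmk : m < k := Finset.mem_range.mp hm
      simp only [pA, Matrix.cons_val_zero, Matrix.cons_val_one] at hbox₀ hbox₁
      rcases Nat.lt_or_ge i m with him | hmi
      · exact hbox₀.not_ge (h_fst (Set.mem_Iic.mpr hik) (Set.mem_Iic.mpr hmk.le) him)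
      · exact hbox₁.not_ge
          (h_snd (Set.mem_Iic.mpr hmk) (Set.mem_Iic.mpr hik) (Nat.succ_le_succ hmi))
    · obtain ⟨m, hm, rfl⟩ := Finset.mem_image.mp hxB
      have hmk : m < k := Finset.mem_range.mp hm
      have hne : m ≠ i := by
        rintro rfl
        exact hout hx
      have h_pB_snd : pB q γ δ m 1 = q (m + 1) 1 - δ := by
        unfold pB
        split_ifs with h <;> simp [h]
      rcases lt_or_gt_of_ne hne with hmi | him
      · have h_gap := hδ_gap (m + 1) (by omega) (by omega)
        have h_le : q (i + 1) 1 ≤ q (m + 1 + 1) 1 :=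
          h_snd (Set.mem_Iic.mpr (by omega)) (Set.mem_Iic.mpr hik) (by omega)
        linarith
      · have h_pB_fst : pB q γ δ m 0 = q m 0 := by
          simp [pB, Nat.ne_zero_of_lt him]
        rw [h_pB_fst] at hbox₀
        exact hbox₀.not_ge (h_fst (Set.mem_Iic.mpr hik) (Set.mem_Iic.mpr hmk.le) him)
  refine ⟨h_empty, ?_⟩
  calc 1 - α = vol (q (i + 1)) := by rw [vol, Fin.prod_univ_two, hq_curve (i + 1) hik]
    _ = delta (q (i + 1)) PC := (delta_eq_vol_of_forall_not_inOpenBox h_empty).symm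
    _ ≤ starDisc PC :=
      le_starDisc (fun j => ⟨(hq_mem _ hik j).1.le, (hq_mem _ hik j).2⟩) PC
end
end

section
/- For every integer k ≥ 2 there exist a real number α with 0 < α < 1/(2k), points q_1,…,q_{k+1} ∈ (0,1]^2, and reals δ, γ > 0 satisfying all of the following: q_{i,1} q_{i,2} = 1 − α for all 1 ≤ i ≤ k+1; q_{1,2} = 1; q_{k+1,1} = 1; q_{i,1} < q_{i+1,1} for 1 ≤ i ≤ k; q_{i,1} q_{i+1,2} > 1 − 1/(2k) for 1 ≤ i ≤ k; δ < q_{i+1,2} − q_{i+2,2} for all 1 ≤ i ≤ k−1; q_{i,1}(q_{i+1,2} − δ) ≥ 1 − 1/k for 2 ≤ i ≤ k; γ < q_{1,1}; and (q_{1,1} − γ)(q_{2,2} − δ) ≥ 1 − 1/k. (That is, the data needed for the constructions of the point sets P_A and P_B exist for every k ≥ 2.) -/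
/-- For every `k ≥ 2` the data required for the constructions of the point sets `P_A`
and `P_B` exist: a real `α` with `0 < α < 1/(2k)`, points `q_0, …, q_k ∈ (0,1]^2`
(here `q i` is the paper's `q_{i+1}`) on the curve `xy = 1 - α` with `q_{0,2} = 1`,
`q_{k,1} = 1`, strictly increasing first coordinates and `q_{i,1} q_{i+1,2} > 1 - 1/(2k)`,
together with shifts `δ, γ > 0` satisfying the `P_B` constraints. -/
theorem construction_data_exists (k : ℕ) (hk : 2 ≤ k) :
    ∃ (α : ℝ) (q : ℕ → Fin 2 → ℝ) (δ γ : ℝ),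
      0 < α ∧ α < 1 / (2 * k) ∧ 0 < δ ∧ 0 < γ ∧
      (∀ i ≤ k, ∀ j, 0 < q i j ∧ q i j ≤ 1) ∧
      (∀ i ≤ k, q i 0 * q i 1 = 1 - α) ∧
      q 0 1 = 1 ∧ q k 0 = 1 ∧
      (∀ i < k, q i 0 < q (i + 1) 0) ∧
      (∀ i < k, 1 - 1 / (2 * k) < q i 0 * q (i + 1) 1) ∧
      (∀ i, 1 ≤ i → i < k → δ < q i 1 - q (i + 1) 1) ∧
      (∀ i, 1 ≤ i → i < k → 1 - 1 / (k : ℝ) ≤ q i 0 * (q (i + 1) 1 - δ)) ∧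
      γ < q 0 0 ∧
      1 - 1 / (k : ℝ) ≤ (q 0 0 - γ) * (q 1 1 - δ) := by
  have hk' : (2 : ℝ) ≤ k := by exact_mod_cast hk
  have hk0 : (k : ℝ) ≠ 0 := by positivity
  obtain ⟨u, hu⟩ : ∃ u : ℝ, u = 1 / (k : ℝ) := ⟨_, rfl⟩
  have hu2 : 1 / (2 * (k : ℝ)) = u / 2 := by rw [hu]; field_simp
  have hu0 : 0 < u := by rw [hu]; positivity
  have huk : (k : ℝ) * u = 1 := by rw [hu]; field_simp
  have huh : u ≤ 1 / 2 := by nlinarith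
  obtain ⟨d, hd⟩ : ∃ d : ℝ, d = u ^ 2 / 8 := ⟨_, rfl⟩
  have hd0 : 0 < d := by rw [hd]; positivity
  have hdu : d ≤ u / 16 := by rw [hd]; nlinarith
  obtain ⟨r, hr⟩ : ∃ r : ℝ, r = 1 - 2 * d := ⟨_, rfl⟩
  have hr0 : 0 < r := by linarith
  have hr1 : r < 1 := by linarith
  have hle (n : ℕ) : r ^ n ≤ 1 := pow_le_one₀ hr0.le hr1.le
  have hpow : 1 - u / 2 < r ^ (k + 1) := by
    have h := one_add_mul_le_pow (a := -(2 * d)) (by linarith) (k + 1)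
    have hkd : (k : ℝ) * d = u / 8 := by rw [hd]; linear_combination u / 8 * huk
    rw [← sub_eq_add_neg 1 (2 * d), ← hr] at h
    push_cast at h
    linarith
  have hanti {m n : ℕ} (h : m ≤ n) : r ^ n ≤ r ^ m :=
    pow_le_pow_of_le_one hr0.le hr1.le h
  have hsplit (i : ℕ) (hi : i ≤ k) : r ^ (k - i) * r ^ (i + 1) = r ^ (k + 1) := by
    rw [← pow_add]; congr 1; omega
  have hkpow := hanti (Nat.le_succ k)
  rw [Nat.succ_eq_add_one] at hkpow
  rw [hu2, ← hu]
  refine ⟨1 - r ^ k, fun i ↦ ![r ^ (k - i), r ^ i], d, d, ?_, by linarith, hd0, hd0,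
    ?_, ?_, by simp, by simp, ?_, ?_, ?_, ?_, ?_, ?_⟩
  · have := pow_lt_one₀ hr0.le hr1 (n := k) (by omega)
    linarith
  · intro i _ j
    fin_cases j
    · exact ⟨pow_pos hr0 _, hle _⟩
    · exact ⟨pow_pos hr0 _, hle _⟩
  · intro i hi
    simp [← pow_add, Nat.sub_add_cancel hi]
  · intro i hi
    exact pow_lt_pow_right_of_lt_one₀ hr0 hr1 (by omega)
  · intro i hi
    change _ < r ^ (k - i) * r ^ (i + 1)
    rwa [hsplit i hi.le]
  · intro i _ hi
    change d < r ^ i - r ^ (i + 1)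
    have h : r ^ (k + 1) ≤ r ^ i := hanti (by omega)
    rw [pow_succ, hr] at *
    nlinarith
  · intro i _ hi
    change _ ≤ r ^ (k - i) * (r ^ (i + 1) - d)
    rw [mul_sub, hsplit i hi.le]
    nlinarith [hle (k - i)]
  · change d < r ^ (k - 0)
    rw [Nat.sub_zero]
    linarith
  · change _ ≤ (r ^ (k - 0) - d) * (r ^ 1 - d)
    rw [Nat.sub_zero, pow_one]
    rw [pow_succ] at hpow
    nlinarith [hle k]
end

section
/- For every integer k ≥ 2 there exists a point set P ⊆ [0,1]^2 with |P| = 2k and a subset Q ⊆ P with |Q| = k such that Q is a local minimum for (k−1)-swaps of the star discrepancy subset selection problem with parameter k on P, but Q is not a global minimum: there exists Q' ⊆ P with |Q'| = k and d*∞(Q') < d*∞(Q). -/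
open scoped Classical

noncomputable section

/-- The `n`-th point of a geometric sequence on the hyperbola `x * y = θ ^ (2 * k + 2)`. -/
def hyperbolaPoint (θ : ℝ) (k n : ℕ) : Fin 2 → ℝ := ![θ ^ (2 * k - n), θ ^ (n + 2)]

/-- The `k` points `hyperbolaPoint θ k n` with `n < 2 * k` and `n ≡ s` modulo `2`. -/
def alternatePoints (θ : ℝ) (k s : ℕ) : Finset (Fin 2 → ℝ) :=
  (Finset.range k).image fun i => hyperbolaPoint θ k (2 * i + s)

lemma delta_le_vol {d : ℕ} (q : Fin d → ℝ) (P : Finset (Fin d → ℝ)) : delta q P ≤ vol q := by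
  unfold delta
  have : 0 ≤ ((P.filter (fun x => inOpenBox q x)).card : ℝ) / (P.card : ℝ) := by positivity
  linarith

lemma deltaBar_le {d : ℕ} (q : Fin d → ℝ) (P : Finset (Fin d → ℝ)) :
    deltaBar q P ≤ 1 - vol q := by
  unfold deltaBar
  have : ((P.filter (fun x => inClosedBox q x)).card : ℝ) / (P.card : ℝ) ≤ 1 :=
    div_le_one_of_le₀ (by exact_mod_cast Finset.card_filter_le _ _) (by positivity)
  linarith

lemma vol_le_starDisc {d : ℕ} {q : Fin d → ℝ} {P : Finset (Fin d → ℝ)}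
    (hq : ∀ j, 0 ≤ q j ∧ q j ≤ 1) (hP : ∀ p ∈ P, ¬ inOpenBox q p) : vol q ≤ starDisc P := by
  have hδ : delta q P = vol q := by
    simp [delta, Finset.filter_false_of_mem hP]
  calc vol q ≤ max (delta q P) (deltaBar q P) := hδ ▸ le_max_left _ _
    _ ≤ starDisc P := by
      refine le_csSup ⟨1, ?_⟩ ⟨q, hq, rfl⟩
      rintro _ ⟨r, hr, rfl⟩
      exact max_le ((delta_le_vol r P).trans (vol_le_one hr))
        ((deltaBar_le r P).trans (by linarith [vol_nonneg hr]))

lemma starDisc_le {d : ℕ} {P : Finset (Fin d → ℝ)} {c : ℝ} (hc : 0 ≤ c)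
    (hcard : 1 - 1 / (P.card : ℝ) ≤ c)
    (hvol : ∀ p ∈ P, 1 - c ≤ vol p)
    (hempty : ∀ q : Fin d → ℝ, (∀ j, 0 ≤ q j ∧ q j ≤ 1) →
      (∀ p ∈ P, ¬ inOpenBox q p) → vol q ≤ c) : starDisc P ≤ c := by
  refine csSup_le ⟨_, fun _ => 0, fun _ => ⟨le_rfl, zero_le_one⟩, rfl⟩ ?_
  rintro _ ⟨q, hq, rfl⟩
  refine max_le ?_ ?_
  · by_cases h : ∀ p ∈ P, ¬ inOpenBox q p
    · exact (delta_le_vol q P).trans (hempty q hq h)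
    · push Not at h
      obtain ⟨p, hp, hpq⟩ := h
      have h1 : 1 ≤ (P.filter (fun x => inOpenBox q x)).card :=
        Finset.card_pos.2 ⟨p, Finset.mem_filter.2 ⟨hp, hpq⟩⟩
      have h2 : 1 / (P.card : ℝ) ≤
          ((P.filter (fun x => inOpenBox q x)).card : ℝ) / (P.card : ℝ) := by
        gcongr
        exact_mod_cast h1
      have h3 := vol_le_one hq
      unfold delta
      linarith
  · by_cases h : ∀ p ∈ P, ¬ inClosedBox q p
    · have h0 : deltaBar q P = -vol q := by simp [deltaBar, Finset.filter_false_of_mem h]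
      linarith [vol_nonneg hq]
    · push Not at h
      obtain ⟨p, hp, hpq⟩ := h
      have h1 : vol p ≤ vol q :=
        Finset.prod_le_prod (fun j _ => (hpq j).1) fun j _ => (hpq j).2
      linarith [deltaBar_le q P, hvol p hp]

section HyperbolaPoint

variable {θ : ℝ} {k : ℕ}

lemma hyperbolaPoint_injective (h0 : 0 < θ) (h1 : θ < 1) :
    Function.Injective (hyperbolaPoint θ k) := by
  intro m n h
  have h2 : θ ^ (m + 2) = θ ^ (n + 2) := by simpa [hyperbolaPoint] using congrFun h 1
  have := pow_right_injective₀ h0 h1.ne h2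
  omega

lemma hyperbolaPoint_mem_unit (h0 : 0 < θ) (h1 : θ < 1) (n : ℕ) (j : Fin 2) :
    0 ≤ hyperbolaPoint θ k n j ∧ hyperbolaPoint θ k n j ≤ 1 := by
  have h (m : ℕ) : 0 ≤ θ ^ m ∧ θ ^ m ≤ 1 := ⟨by positivity, pow_le_one₀ h0.le h1.le⟩
  fin_cases j <;> exact h _

lemma vol_hyperbolaPoint {n : ℕ} (hn : n ≤ 2 * k) :
    vol (hyperbolaPoint θ k n) = θ ^ (2 * k + 2) := by
  simp only [vol, Fin.prod_univ_two, hyperbolaPoint, Matrix.cons_val_zero, Matrix.cons_val_one]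
  rw [← pow_add]
  congr 1
  omega

lemma card_alternatePoints (h0 : 0 < θ) (h1 : θ < 1) (s : ℕ) :
    (alternatePoints θ k s).card = k := by
  rw [alternatePoints, Finset.card_image_of_injective, Finset.card_range]
  intro i j hij
  have := hyperbolaPoint_injective h0 h1 hij
  omega

lemma alternatePoints_subset {s : ℕ} (hs : s ≤ 1) :
    alternatePoints θ k s ⊆ (Finset.range (2 * k)).image (hyperbolaPoint θ k) := by
  intro p hp
  obtain ⟨i, hi, rfl⟩ := Finset.mem_image.1 hp
  have := Finset.mem_range.1 hi
  exact Finset.mem_image_of_mem _ (Finset.mem_range.2 (by omega))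

lemma vol_le_of_disjoint_alternatePoints (h0 : 0 < θ) (h1 : θ < 1) (hk : 1 ≤ k) {s : ℕ}
    {q : Fin 2 → ℝ} (hq : ∀ j, 0 ≤ q j ∧ q j ≤ 1)
    (hempty : ∀ p ∈ alternatePoints θ k s, ¬ inOpenBox q p) : vol q ≤ θ ^ (2 * k - s) := by
  have hv : vol q = q 0 * q 1 := by simp [vol]
  obtain ⟨hu0, hu1⟩ := hq 0
  obtain ⟨hv0, hv1⟩ := hq 1
  have hanti {m n : ℕ} (h : m ≤ n) : θ ^ n ≤ θ ^ m := pow_le_pow_of_le_one h0.le h1.le h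
  have hmiss : ∀ i < k, q 0 ≤ θ ^ (2 * k - (2 * i + s)) ∨ q 1 ≤ θ ^ (2 * i + s + 2) := by
    intro i hi
    by_contra! h
    refine hempty _ (Finset.mem_image_of_mem _ (Finset.mem_range.2 hi)) fun j => ?_
    refine ⟨(hyperbolaPoint_mem_unit h0 h1 _ j).1, ?_⟩
    fin_cases j
    · exact h.1
    · exact h.2
  by_contra! hlt
  rw [hv] at hlt
  have hstep : ∀ i < k, q 1 ≤ θ ^ (2 * i + s + 2) := by
    intro i
    induction i with
    | zero =>
      intro hi
      refine (hmiss 0 hi).resolve_left fun h => ?_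
      rw [mul_zero, zero_add] at h
      nlinarith
    | succ i ih =>
      intro hi
      refine (hmiss (i + 1) hi).resolve_left fun h => ?_
      have h2 := mul_le_mul h (ih (by omega)) hv0 (by positivity)
      rw [← pow_add] at h2
      have h3 := h2.trans (hanti (m := 2 * k - s) (by omega))
      linarith
  have h2 := (hstep (k - 1) (by omega)).trans (hanti (m := 2 * k - s) (by omega))
  nlinarith

lemma starDisc_alternatePoints_le (h0 : 0 < θ) (h1 : θ < 1) (hk : 1 ≤ k) {s : ℕ} (hs : s ≤ 1)
    (hcard : 1 - 1 / (k : ℝ) ≤ θ ^ (2 * k)) (hhalf : 1 / 2 ≤ θ ^ (2 * k + 2)) :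
    starDisc (alternatePoints θ k s) ≤ θ ^ (2 * k - s) := by
  have hanti {m n : ℕ} (h : m ≤ n) : θ ^ n ≤ θ ^ m := pow_le_pow_of_le_one h0.le h1.le h
  refine starDisc_le (by positivity) ?_ ?_ fun q hq hempty =>
    vol_le_of_disjoint_alternatePoints h0 h1 hk hq hempty
  · rw [card_alternatePoints h0 h1]
    exact hcard.trans (hanti (by omega))
  · intro p hp
    obtain ⟨i, hi, rfl⟩ := Finset.mem_image.1 hp
    have := Finset.mem_range.1 hi
    rw [vol_hyperbolaPoint (by omega)]
    linarith [hanti (show 2 * k - s ≤ 2 * k + 2 by omega)]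

/-- The box `[0, θ ^ (2k - 1 - b)) × [0, θ ^ b)` contains only the points numbered
`b - 1` and `b`. -/
lemma pow_le_starDisc (h0 : 0 < θ) (h1 : θ < 1) {N : Finset ℕ} {b : ℕ}
    (hb : b < 2 * k) (hbN : ∀ n ∈ N, n ≠ b ∧ n + 1 ≠ b) :
    θ ^ (2 * k - 1) ≤ starDisc (N.image (hyperbolaPoint θ k)) := by
  have hvol : vol ![θ ^ (2 * k - 1 - b), θ ^ b] = θ ^ (2 * k - 1) := by
    simp only [vol, Fin.prod_univ_two, Matrix.cons_val_zero, Matrix.cons_val_one]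
    rw [← pow_add]
    congr 1
    omega
  rw [← hvol]
  refine vol_le_starDisc ?_ ?_
  · have h (m : ℕ) : 0 ≤ θ ^ m ∧ θ ^ m ≤ 1 := ⟨by positivity, pow_le_one₀ h0.le h1.le⟩
    intro j
    fin_cases j <;> exact h _
  · intro p hp hbox
    obtain ⟨n, hn, rfl⟩ := Finset.mem_image.1 hp
    have hx : θ ^ (2 * k - n) < θ ^ (2 * k - 1 - b) := (hbox 0).2
    have hy : θ ^ (n + 2) < θ ^ b := (hbox 1).2
    rw [pow_lt_pow_iff_right_of_lt_one₀ h0 h1] at hx hy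
    have := hbN n hn
    omega

end HyperbolaPoint

/-- A `k`-element set meeting `{0}` and every pair of consecutive numbers below `2 * k`
contains no odd number below `2 * k`. -/
lemma odd_notMem_of_hits_consecutive {k : ℕ} {N : Finset ℕ} (hN : N ⊆ Finset.range (2 * k))
    (hcard : N.card = k) (h0 : 0 ∈ N) (hhit : ∀ b, b + 1 < 2 * k → b ∈ N ∨ b + 1 ∈ N) :
    ∀ i < k, 2 * i + 1 ∉ N := by
  have himage : N.image (· / 2) = Finset.range k := by
    ext i
    simp only [Finset.mem_image, Finset.mem_range]
    constructor
    · rintro ⟨n, hn, rfl⟩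
      have := Finset.mem_range.1 (hN hn)
      omega
    · intro hi
      rcases hhit (2 * i) (by omega) with h | h
      · exact ⟨_, h, by omega⟩
      · exact ⟨_, h, by omega⟩
  have hinj : Set.InjOn (· / 2) (N : Set ℕ) := by
    rw [← Finset.card_image_iff, himage, Finset.card_range, hcard]
  have hpair (i : ℕ) (hi : 2 * i ∈ N) : 2 * i + 1 ∉ N := fun h => by
    have := hinj hi h (by dsimp only; omega)
    omega
  have heven : ∀ i < k, 2 * i ∈ N := by
    intro i
    induction i with
    | zero => exact fun _ => h0
    | succ i ih =>
      intro hi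
      exact (hhit (2 * i + 1) (by omega)).resolve_left (hpair i (ih (by omega)))
  exact fun i hi => hpair i (heven i hi)

lemma exists_pow_bounds {k : ℕ} (hk : 2 ≤ k) :
    ∃ θ : ℝ, 0 < θ ∧ θ < 1 ∧ 1 - 1 / (k : ℝ) ≤ θ ^ (2 * k) ∧ 1 / 2 ≤ θ ^ (2 * k + 2) := by
  have hk2 : (2 : ℝ) ≤ k := by exact_mod_cast hk
  have hε : 1 / (4 * (k : ℝ) ^ 2) ≤ 1 / 16 := by
    apply one_div_le_one_div_of_le <;> nlinarith
  have hε0 : 0 < 1 / (4 * (k : ℝ) ^ 2) := by positivity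
  have bernoulli (n : ℕ) := one_add_mul_le_pow (a := -(1 / (4 * (k : ℝ) ^ 2))) (by linarith) n
  refine ⟨1 + -(1 / (4 * (k : ℝ) ^ 2)), by linarith, by linarith,
    le_trans ?_ (bernoulli _), le_trans ?_ (bernoulli _)⟩
  · push_cast
    have : 2 * (k : ℝ) * (1 / (4 * (k : ℝ) ^ 2)) ≤ 1 / k := by
      field_simp
      norm_num
    linarith
  · push_cast
    have : (2 * (k : ℝ) + 2) * (1 / (4 * (k : ℝ) ^ 2)) ≤ 1 / 2 := by
      rw [mul_one_div, div_le_iff₀ (by positivity)]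
      nlinarith
    linarith

/-- For every `k ≥ 2` there is a `2k`-point set `P ⊆ [0,1]^2` and a `k`-element subset
`Q ⊆ P` that is a local minimum for `(k-1)`-swaps of the star discrepancy subset
selection problem with parameter `k` on `P`, but not a global minimum. -/
theorem exists_local_min_not_global_dim2 (k : ℕ) (hk : 2 ≤ k) :
    ∃ P : Finset (Fin 2 → ℝ),
      (∀ p ∈ P, ∀ j, 0 ≤ p j ∧ p j ≤ 1) ∧ P.card = 2 * k ∧
      ∃ Q ⊆ P, Q.card = k ∧
        (∀ Q' ⊆ P, Q'.card = k → (Q \ Q').card ≤ k - 1 →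
          starDisc Q ≤ starDisc Q') ∧
        ∃ Q' ⊆ P, Q'.card = k ∧ starDisc Q' < starDisc Q := by
  obtain ⟨θ, h0, h1, hcard, hhalf⟩ := exists_pow_bounds hk
  have hinj := hyperbolaPoint_injective (k := k) h0 h1
  have hlower : ∀ Q' ⊆ (Finset.range (2 * k)).image (hyperbolaPoint θ k), Q'.card = k →
      (∃ i < k, hyperbolaPoint θ k (2 * i + 1) ∈ Q') → θ ^ (2 * k - 1) ≤ starDisc Q' := by
    rintro Q' hQ' hQ'card ⟨i, hi, hmem⟩
    obtain ⟨N, hN, rfl⟩ := Finset.subset_image_iff.1 hQ'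
    rw [Finset.card_image_of_injective _ hinj] at hQ'card
    rw [hinj.mem_finset_image] at hmem
    by_contra! hlt
    have hmeet (b : ℕ) (hb : b < 2 * k) : ∃ n ∈ N, n = b ∨ n + 1 = b := by
      by_contra! h
      exact hlt.not_ge (pow_le_starDisc h0 h1 hb h)
    refine odd_notMem_of_hits_consecutive (by exact_mod_cast hN) hQ'card ?_ ?_ i hi hmem
    · obtain ⟨n, hn, rfl | h⟩ := hmeet 0 (by omega)
      · exact hn
      · omega
    · intro b hb
      obtain ⟨n, hn, rfl | h⟩ := hmeet (b + 1) hb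
      · exact Or.inr hn
      · obtain rfl : n = b := by omega
        exact Or.inl hn
  have hQ := alternatePoints_subset (θ := θ) (k := k) le_rfl
  have hQcard := card_alternatePoints (k := k) h0 h1 1
  refine ⟨(Finset.range (2 * k)).image (hyperbolaPoint θ k), ?_, ?_,
    alternatePoints θ k 1, hQ, hQcard, ?_,
    alternatePoints θ k 0, alternatePoints_subset zero_le_one, card_alternatePoints h0 h1 0, ?_⟩
  · intro p hp
    obtain ⟨n, -, rfl⟩ := Finset.mem_image.1 hp
    exact hyperbolaPoint_mem_unit h0 h1 n
  · rw [Finset.card_image_of_injective _ hinj, Finset.card_range]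
  · intro Q' hQ' hQ'card hswap
    refine (starDisc_alternatePoints_le h0 h1 (by omega) le_rfl hcard hhalf).trans
      (hlower Q' hQ' hQ'card ?_)
    by_contra! h
    have hdisj : Disjoint (alternatePoints θ k 1) Q' := by
      refine Finset.disjoint_left.2 fun p hp => ?_
      obtain ⟨i, hi, rfl⟩ := Finset.mem_image.1 hp
      exact h i (Finset.mem_range.1 hi)
    rw [Finset.sdiff_eq_self_of_disjoint hdisj, hQcard] at hswap
    omega
  · calc starDisc (alternatePoints θ k 0)
        ≤ θ ^ (2 * k) :=
          starDisc_alternatePoints_le h0 h1 (by omega) zero_le_one hcard hhalf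
      _ < θ ^ (2 * k - 1) := pow_lt_pow_right_of_lt_one₀ h0 h1 (by omega)
      _ ≤ starDisc (alternatePoints θ k 1) :=
          hlower _ hQ hQcard ⟨0, by omega, Finset.mem_image.2 ⟨0, by simp; omega, rfl⟩⟩
end
end
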